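/- For every non-negative integer ℓ, with Δ_{e_k} the difference operator (Δ_{e_k} P)(x) := P(x + e_k) − P(x) for the standard basis e_1,…,e_r of ℝ^r, one has (Δ_{e_1} ∘ Δ_{e_2} ∘ ⋯ ∘ Δ_{e_r})(P_ℓ)(x) = (−1)^r · (Π_{α ∈ Φ⁺} Σ_{k=1}^r x_k (λ_k, α^∨))^ℓ, a polynomial with integer coefficients, and the same expression equals ∂^r Q_ℓ(x) / (∂x_1 ∂x_2 ⋯ ∂x_r). -/

import Mathlib

open MeasureTheory Complex RealInnerProductSpace
open scoped Classical

noncomputable section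

/-- The data of a reduced crystallographic root system `Φ` spanning a real inner
product space `E`, together with a choice of positive system `Φ⁺`, an ordering
of the simple roots, and the corresponding fundamental dominant weights. -/
structure RootSystemData (r : ℕ) (E : Type*) [NormedAddCommGroup E] [InnerProductSpace ℝ E] where
  /-- the set of roots -/
  roots : Finset E
  /-- the set of positive roots -/
  pos : Finset E
  /-- the (ordered) simple roots of the positive system -/
  simple : Fin r → E
  /-- the fundamental dominant weights -/
  weight : Fin r → E
  ne_zero : ∀ α ∈ roots, α ≠ (0 : E)
  span_eq : Submodule.span ℝ (roots : Set E) = ⊤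
  reduced : ∀ α ∈ roots, ∀ c : ℝ, c • α ∈ roots → c = 1 ∨ c = -1
  crystallographic : ∀ α ∈ roots, ∀ β ∈ roots, ∃ z : ℤ, 2 * ⟪β, α⟫ / ⟪α, α⟫ = (z : ℝ)
  reflection_mem : ∀ α ∈ roots, ∀ β ∈ roots, β - (2 * ⟪β, α⟫ / ⟪α, α⟫) • α ∈ roots
  pos_subset : pos ⊆ roots
  mem_pos_or : ∀ α ∈ roots, α ∈ pos ∨ -α ∈ pos
  not_both : ∀ α ∈ pos, -α ∉ pos
  simple_mem_pos : ∀ i, simple i ∈ pos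
  simple_inj : Function.Injective simple
  simple_base : ∀ α ∈ pos, ∃ c : Fin r → ℕ, α = ∑ i, (c i : ℝ) • simple i
  weight_dual : ∀ i j, ⟪weight i, (2 / ⟪simple j, simple j⟫) • simple j⟫ = (if i = j then (1:ℝ) else 0)

variable {r : ℕ} {E : Type*} [NormedAddCommGroup E] [InnerProductSpace ℝ E]

/-- The pairing `(λ_i, α^∨)` of the `i`-th fundamental weight with the coroot of `α`. -/
def RootSystemData.pairing (S : RootSystemData r E) (i : Fin r) (α : E) : ℝ :=
  ⟪S.weight i, (2 / ⟪α, α⟫) • α⟫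

/-- The zeta series `ζ_Φ(s,x)` attached to the root system data. -/
def zetaRS (S : RootSystemData r E) (s : ℂ) (x : Fin r → ℝ) : ℂ :=
  ∑' m : Fin r → ℕ, ∏ α ∈ S.pos,
    (((∑ i, ((m i : ℝ) + x i) * S.pairing i α : ℝ)) : ℂ) ^ (-s)

/-- The zeta integral `𝒵_Φ(s,x)` attached to the root system data. -/
def zetaIntRS (S : RootSystemData r E) (s : ℂ) (x : Fin r → ℝ) : ℂ :=
  ∫ t in {t : Fin r → ℝ | ∀ i, 0 < t i}, ∏ α ∈ S.pos,
    (((∑ i, (t i + x i) * S.pairing i α : ℝ)) : ℂ) ^ (-s)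

/-- `v` is the value `P_ℓ(x) = ζ_Φ(-ℓ,x)` of the meromorphic continuation of the
zeta series at `s = -ℓ`. -/
def IsPValue (S : RootSystemData r E) (l : ℕ) (x : Fin r → ℝ) (v : ℂ) : Prop :=
  ∃ F : ℂ → ℂ, (∀ s : ℂ, (r : ℝ) < s.re → F s = zetaRS S s x) ∧
    MeromorphicOn F Set.univ ∧ AnalyticAt ℂ F (-(l : ℂ)) ∧ F (-(l : ℂ)) = v

/-- `v` is the value `Q_ℓ(x) = 𝒵_Φ(-ℓ,x)` of the meromorphic continuation of the
zeta integral at `s = -ℓ`. -/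
def IsQValue (S : RootSystemData r E) (l : ℕ) (x : Fin r → ℝ) (v : ℂ) : Prop :=
  ∃ F : ℂ → ℂ, (∀ s : ℂ, (r : ℝ) < s.re → F s = zetaIntRS S s x) ∧
    MeromorphicOn F Set.univ ∧ AnalyticAt ℂ F (-(l : ℂ)) ∧ F (-(l : ℂ)) = v

/-- The difference operator `Δ_{e_i}` on functions of `r` real variables. -/
def deltaOp {m : ℕ} (i : Fin m) (f : (Fin m → ℝ) → ℂ) : (Fin m → ℝ) → ℂ :=
  fun x => f (x + Pi.single i 1) - f x

/-- The composition `Δ_{e_1} ∘ Δ_{e_2} ∘ ⋯ ∘ Δ_{e_m}`. -/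
def deltaAll {m : ℕ} (f : (Fin m → ℝ) → ℂ) : (Fin m → ℝ) → ℂ :=
  (List.finRange m).foldr (fun i acc => deltaOp i acc) f

/-- Real partial derivative in the `i`-th coordinate. -/
def pder {m : ℕ} (i : Fin m) (h : (Fin m → ℝ) → ℂ) : (Fin m → ℝ) → ℂ :=
  fun x => fderiv ℝ h x (Pi.single i 1)

/-- The mixed partial derivative `∂^m/(∂x_1⋯∂x_m)`. -/
def mixedDeriv {m : ℕ} (h : (Fin m → ℝ) → ℂ) : (Fin m → ℝ) → ℂ :=
  (List.finRange m).foldr (fun i acc => pder i acc) h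

/-- The difference operator with step `h i` in the `i`-th coordinate. -/
def shiftDiff {m : ℕ} (h : Fin m → ℝ) (i : Fin m) (f : (Fin m → ℝ) → ℂ) : (Fin m → ℝ) → ℂ :=
  fun x => f (x + Pi.single i (h i)) - f x

lemma add_single_pos {m : ℕ} {h x : Fin m → ℝ} (hh : ∀ i, 0 ≤ h i) (hx : ∀ i, 0 < x i)
    (i j : Fin m) : 0 < (x + Pi.single i (h i) : Fin m → ℝ) j := by
  by_cases hij : j = i
  · subst hij; simpa using add_pos_of_pos_of_nonneg (hx j) (hh j)
  · simpa [Pi.single_eq_of_ne hij] using hx j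

lemma foldr_shiftDiff_congr {m : ℕ} {h : Fin m → ℝ} (hh : ∀ i, 0 ≤ h i)
    {f g : (Fin m → ℝ) → ℂ} (hfg : ∀ x, (∀ i, 0 < x i) → f x = g x) (L : List (Fin m)) :
    ∀ x : Fin m → ℝ, (∀ i, 0 < x i) → L.foldr (shiftDiff h) f x = L.foldr (shiftDiff h) g x := by
  induction L with
  | nil => exact hfg
  | cons i L ih =>
    intro x hx
    simp only [List.foldr_cons, shiftDiff]
    rw [ih x hx, ih _ (add_single_pos hh hx i)]

lemma foldr_shiftDiff_meromorphicOn {m : ℕ} {h : Fin m → ℝ} (hh : ∀ i, 0 ≤ h i)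
    {F : (Fin m → ℝ) → ℂ → ℂ} {z : ℂ}
    (hF : ∀ x, (∀ i, 0 < x i) → MeromorphicOn (F x) Set.univ ∧ AnalyticAt ℂ (F x) z)
    (L : List (Fin m)) :
    ∀ x : Fin m → ℝ, (∀ i, 0 < x i) →
      MeromorphicOn (fun s => L.foldr (shiftDiff h) (fun y => F y s) x) Set.univ ∧
      AnalyticAt ℂ (fun s => L.foldr (shiftDiff h) (fun y => F y s) x) z := by
  induction L with
  | nil => exact hF
  | cons i L ih =>
    intro x hx
    simp only [List.foldr_cons, shiftDiff]
    obtain ⟨h1, h2⟩ := ih x hx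
    obtain ⟨h3, h4⟩ := ih _ (add_single_pos hh hx i)
    exact ⟨h3.fun_sub h1, h4.fun_sub h2⟩

/-- A meromorphic function on `ℂ` that agrees with an entire function on a right half plane
agrees with it at every point of analyticity. -/
lemma eq_of_eqOn_halfPlane {F G : ℂ → ℂ} {z : ℂ} {c : ℝ} (hF : MeromorphicOn F Set.univ)
    (hFz : AnalyticAt ℂ F z) (hG : Differentiable ℂ G) (hFG : ∀ s : ℂ, c < s.re → F s = G s) :
    F z = G z := by
  have hD : MeromorphicOn (fun s => F s - G s) Set.univ :=
    hF.fun_sub fun s _ => (hG.analyticAt s).meromorphicAt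
  have htop : meromorphicOrderAt (fun s => F s - G s) ((c + 1 : ℝ) : ℂ) = ⊤ := by
    rw [meromorphicOrderAt_eq_top_iff]
    have ho : IsOpen {s : ℂ | c < s.re} := isOpen_lt continuous_const Complex.continuous_re
    have := ho.mem_nhds (show ((c + 1 : ℝ) : ℂ) ∈ {s : ℂ | c < s.re} by simp)
    filter_upwards [nhdsWithin_le_nhds this] with s hs
    rw [hFG s hs, sub_self]
  have hz : meromorphicOrderAt (fun s => F s - G s) z = ⊤ := by
    by_contra hne
    exact (hD.exists_meromorphicOrderAt_ne_top_iff_forall_mem isConnected_univ).1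
      ⟨z, trivial, hne⟩ _ trivial htop
  rw [meromorphicOrderAt_eq_top_iff] at hz
  have hcont : Filter.Tendsto (fun s => F s - G s) (nhdsWithin z {z}ᶜ) (nhds (F z - G z)) :=
    (hFz.continuousAt.sub (hG z).continuousAt).tendsto.mono_left nhdsWithin_le_nhds
  have h0 := tendsto_nhds_unique hcont (tendsto_const_nhds.congr' (hz.mono fun _ h => h.symm))
  exact sub_eq_zero.1 h0

/-- Differences of values at `z` of meromorphic continuations can be computed on a half plane of
convergence. -/
lemma foldr_shiftDiff_continuation {m : ℕ} {h : Fin m → ℝ} (hh : ∀ i, 0 ≤ h i)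
    {P : (Fin m → ℝ) → ℂ} {Z : ℂ → (Fin m → ℝ) → ℂ} {z : ℂ} {c : ℝ}
    (hP : ∀ x : Fin m → ℝ, (∀ i, 0 < x i) → ∃ F : ℂ → ℂ, (∀ s : ℂ, c < s.re → F s = Z s x) ∧
      MeromorphicOn F Set.univ ∧ AnalyticAt ℂ F z ∧ F z = P x)
    {G : ℂ → ℂ} (hG : Differentiable ℂ G) (L : List (Fin m)) {x : Fin m → ℝ}
    (hx : ∀ i, 0 < x i) (hZ : ∀ s : ℂ, c < s.re → L.foldr (shiftDiff h) (Z s) x = G s) :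
    L.foldr (shiftDiff h) P x = G z := by
  choose! F hF1 hF2 hF3 hF4 using hP
  obtain ⟨hm, ha⟩ := foldr_shiftDiff_meromorphicOn hh (fun x hx => ⟨hF2 x hx, hF3 x hx⟩) L x hx
  refine (foldr_shiftDiff_congr hh (fun y hy => (hF4 y hy).symm) L x hx).trans
    (eq_of_eqOn_halfPlane (c := c) hm ha hG fun s hs => ?_)
  rw [← hZ s hs]
  exact foldr_shiftDiff_congr hh (fun y hy => hF1 y hy s hs) L x hx

namespace RootSystemData

lemma inner_self_pos (S : RootSystemData r E) {α : E} (hα : α ∈ S.pos) : 0 < ⟪α, α⟫ :=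
  real_inner_self_pos.2 (S.ne_zero α (S.pos_subset hα))

lemma inner_weight_simple (S : RootSystemData r E) (i j : Fin r) :
    ⟪S.weight i, S.simple j⟫ = if i = j then ⟪S.simple j, S.simple j⟫ / 2 else 0 := by
  have h := S.weight_dual i j
  have hp := S.inner_self_pos (S.simple_mem_pos j)
  rw [real_inner_smul_right] at h
  split_ifs at h ⊢ with hij
  · field_simp at h ⊢
    linarith
  · exact (mul_eq_zero.1 h).resolve_left (div_pos two_pos hp).ne'

lemma pairing_eq (S : RootSystemData r E) {α : E} {c : Fin r → ℕ}
    (hc : α = ∑ i, (c i : ℝ) • S.simple i) (i : Fin r) :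
    S.pairing i α = c i * ⟪S.simple i, S.simple i⟫ / ⟪α, α⟫ := by
  have : ⟪S.weight i, α⟫ = c i * (⟪S.simple i, S.simple i⟫ / 2) := by
    conv_lhs => rw [hc]
    simp [inner_sum, real_inner_smul_right, inner_weight_simple]
  rw [pairing, real_inner_smul_right, this]
  ring

lemma pairing_nonneg (S : RootSystemData r E) {α : E} (hα : α ∈ S.pos) (i : Fin r) :
    0 ≤ S.pairing i α := by
  obtain ⟨c, hc⟩ := S.simple_base α hα
  rw [S.pairing_eq hc]
  have := S.inner_self_pos hα
  have := S.inner_self_pos (S.simple_mem_pos i)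
  positivity

lemma exists_pairing_pos (S : RootSystemData r E) {α : E} (hα : α ∈ S.pos) :
    ∃ i, 0 < S.pairing i α := by
  obtain ⟨c, hc⟩ := S.simple_base α hα
  have hne : ∃ i, c i ≠ 0 := by
    by_contra! h
    exact S.ne_zero α (S.pos_subset hα) (by rw [hc]; simp [h])
  obtain ⟨i, hi⟩ := hne
  refine ⟨i, ?_⟩
  rw [S.pairing_eq hc]
  have := S.inner_self_pos hα
  have := S.inner_self_pos (S.simple_mem_pos i)
  have : 0 < (c i : ℝ) := by exact_mod_cast Nat.pos_of_ne_zero hi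
  positivity

lemma pairing_simple (S : RootSystemData r E) (i j : Fin r) :
    S.pairing i (S.simple j) = if i = j then 1 else 0 := S.weight_dual i j

/-- The pairing of the vector `∑ k, u k • λ_k` with the coroot of `α`. -/
def linForm (S : RootSystemData r E) (α : E) (u : Fin r → ℝ) : ℝ := ∑ k, u k * S.pairing k α

lemma linForm_simple (S : RootSystemData r E) (j : Fin r) (u : Fin r → ℝ) :
    S.linForm (S.simple j) u = u j := by
  simp [linForm, pairing_simple]

lemma linForm_pos (S : RootSystemData r E) {α : E} (hα : α ∈ S.pos) {u : Fin r → ℝ}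
    (hu : ∀ i, 0 < u i) : 0 < S.linForm α u := by
  obtain ⟨i, hi⟩ := S.exists_pairing_pos hα
  exact Finset.sum_pos' (fun k _ => mul_nonneg (hu k).le (S.pairing_nonneg hα k))
    ⟨i, Finset.mem_univ i, mul_pos (hu i) hi⟩

lemma linForm_mono (S : RootSystemData r E) {α : E} (hα : α ∈ S.pos) {u v : Fin r → ℝ}
    (huv : u ≤ v) : S.linForm α u ≤ S.linForm α v :=
  Finset.sum_le_sum fun k _ => mul_le_mul_of_nonneg_right (huv k) (S.pairing_nonneg hα k)

lemma continuous_linForm (S : RootSystemData r E) (α : E) : Continuous (S.linForm α) := by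
  unfold linForm
  fun_prop

/-- The common summand and integrand of the zeta series and the zeta integral. -/
def zetaTerm (S : RootSystemData r E) (s : ℂ) (u : Fin r → ℝ) : ℂ :=
  ∏ α ∈ S.pos, (S.linForm α u : ℂ) ^ (-s)

lemma norm_zetaTerm (S : RootSystemData r E) (s : ℂ) {u : Fin r → ℝ} (hu : ∀ i, 0 < u i) :
    ‖S.zetaTerm s u‖ = ∏ α ∈ S.pos, S.linForm α u ^ (-s.re) := by
  rw [zetaTerm, norm_prod]
  exact Finset.prod_congr rfl fun α hα => by
    rw [Complex.norm_cpow_eq_rpow_re_of_pos (S.linForm_pos hα hu), Complex.neg_re]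

lemma exists_norm_zetaTerm_le (S : RootSystemData r E) {s : ℂ} (hs : 0 ≤ s.re) {x : Fin r → ℝ}
    (hx : ∀ i, 0 < x i) :
    ∃ C : ℝ, 0 ≤ C ∧ ∀ u, x ≤ u → ‖S.zetaTerm s u‖ ≤ C * ∏ i, u i ^ (-s.re) := by
  have hsub : Finset.univ.image S.simple ⊆ S.pos := fun α hα => by
    obtain ⟨i, -, rfl⟩ := Finset.mem_image.1 hα
    exact S.simple_mem_pos i
  refine ⟨∏ α ∈ S.pos \ Finset.univ.image S.simple, S.linForm α x ^ (-s.re),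
    Finset.prod_nonneg fun α hα => Real.rpow_nonneg
      (S.linForm_pos (Finset.mem_sdiff.1 hα).1 hx).le _, fun u hu => ?_⟩
  have hu0 : ∀ i, 0 < u i := fun i => (hx i).trans_le (hu i)
  rw [S.norm_zetaTerm s hu0, ← Finset.prod_sdiff hsub,
    Finset.prod_image fun i _ j _ h => S.simple_inj h]
  simp_rw [linForm_simple]
  refine mul_le_mul_of_nonneg_right (Finset.prod_le_prod (fun α hα => ?_) fun α hα => ?_)
    (Finset.prod_nonneg fun i _ => Real.rpow_nonneg (hu0 i).le _)
  · exact Real.rpow_nonneg (S.linForm_pos (Finset.mem_sdiff.1 hα).1 hu0).le _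
  · have hα' := (Finset.mem_sdiff.1 hα).1
    exact Real.rpow_le_rpow_of_nonpos (S.linForm_pos hα' hx) (S.linForm_mono hα' hu)
      (neg_nonpos.2 hs)

lemma zetaTerm_neg_natCast (S : RootSystemData r E) (l : ℕ) (u : Fin r → ℝ) :
    S.zetaTerm (-(l : ℂ)) u = (∏ α ∈ S.pos, (S.linForm α u : ℂ)) ^ l := by
  simp [zetaTerm, Finset.prod_pow]

lemma differentiable_zetaTerm (S : RootSystemData r E) {u : Fin r → ℝ} (hu : ∀ i, 0 < u i) :
    Differentiable ℂ fun s => S.zetaTerm s u := by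
  unfold zetaTerm
  refine Differentiable.fun_finsetProd fun α hα => ?_
  have : (S.linForm α u : ℂ) ≠ 0 := by exact_mod_cast (S.linForm_pos hα hu).ne'
  exact fun s => differentiableAt_id.neg.const_cpow (Or.inl this)

lemma measurable_zetaTerm (S : RootSystemData r E) (s : ℂ) : Measurable (S.zetaTerm s) := by
  unfold zetaTerm
  refine Finset.measurable_fun_prod _ fun α _ => ?_
  exact (Complex.measurable_ofReal.comp (S.continuous_linForm α).measurable).pow_const _

end RootSystemData

/-- A product of summable nonnegative families, one for each coordinate, is summable. -/
lemma summable_fintype_prod {ι κ : Type*} [Fintype ι] {f : ι → κ → ℝ}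
    (hf : ∀ i, Summable (f i)) (h0 : ∀ i k, 0 ≤ f i k) :
    Summable fun m : ι → κ => ∏ i, f i (m i) := by
  refine summable_of_sum_le (c := ∏ i, ∑' k, f i k)
    (fun m => Finset.prod_nonneg fun i _ => h0 i _) fun u => ?_
  calc ∑ m ∈ u, ∏ i, f i (m i)
      ≤ ∑ m ∈ Fintype.piFinset fun i => u.image fun m => m i, ∏ i, f i (m i) :=
        Finset.sum_le_sum_of_subset_of_nonneg
          (fun m hm => Fintype.mem_piFinset.2 fun i => Finset.mem_image_of_mem _ hm)
          fun m _ _ => Finset.prod_nonneg fun i _ => h0 i _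
    _ = ∏ i, ∑ k ∈ u.image fun m => m i, f i k := (Finset.prod_univ_sum _ _).symm
    _ ≤ ∏ i, ∑' k, f i k := Finset.prod_le_prod
        (fun i _ => Finset.sum_nonneg fun k _ => h0 i k)
        fun i _ => (hf i).sum_le_tsum _ fun k _ => h0 i k

lemma summable_zetaTerm (S : RootSystemData r E) {s : ℂ} (hs : 1 < s.re) {x : Fin r → ℝ}
    (hx : ∀ i, 0 < x i) :
    Summable fun m : Fin r → ℕ => S.zetaTerm s ((fun i => (m i : ℝ)) + x) := by
  obtain ⟨C, -, hC⟩ := S.exists_norm_zetaTerm_le (by linarith : 0 ≤ s.re) hx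
  refine Summable.of_norm_bounded (g := fun m : Fin r → ℕ => C * ∏ i, ((m i : ℝ) + x i) ^ (-s.re))
    ((summable_fintype_prod (f := fun i (k : ℕ) => ((k : ℝ) + x i) ^ (-s.re)) (fun i => ?_)
      fun i k => ?_).mul_left C) fun m => hC _ fun i => by simp
  · refine ((Real.summable_one_div_nat_add_rpow (x i) s.re).2 hs).congr fun k => ?_
    have : 0 < (k : ℝ) + x i := by have := hx i; positivity
    rw [abs_of_pos this, Real.rpow_neg this.le, one_div]
  · have := hx i
    positivity

lemma zetaRS_eq_tsum (S : RootSystemData r E) (s : ℂ) (x : Fin r → ℝ) :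
    zetaRS S s x = ∑' m : Fin r → ℕ, S.zetaTerm s ((fun i => (m i : ℝ)) + x) := rfl

lemma foldr_shiftDiff_zetaRS (S : RootSystemData r E) {s : ℂ} (hs : 1 < s.re)
    (L : List (Fin r)) (hL : L.Nodup) :
    ∀ x : Fin r → ℝ, (∀ i, 0 < x i) → L.foldr (shiftDiff 1) (zetaRS S s) x =
      (-1) ^ L.length * ∑' m : Fin r → ℕ, Set.indicator {m | ∀ i ∈ L, m i = 0}
        (fun m => S.zetaTerm s ((fun i => (m i : ℝ)) + x)) m := by
  induction L with
  | nil => intro x _; simp [zetaRS_eq_tsum]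
  | cons i L ih =>
    obtain ⟨hi, hL⟩ := List.nodup_cons.1 hL
    intro x hx
    simp only [List.foldr_cons, shiftDiff, List.length_cons]
    rw [ih hL x hx, ih hL _ (add_single_pos (h := 1) (fun _ => zero_le_one) hx i)]
    set A : Set (Fin r → ℕ) := {m | ∀ j ∈ L, m j = 0}
    set f : (Fin r → ℕ) → ℂ := fun m => S.zetaTerm s ((fun i => (m i : ℝ)) + x)
    have hf : Summable f := summable_zetaTerm S hs hx
    have hshift : ∑' m, A.indicator (fun m : Fin r → ℕ => S.zetaTerm s
        ((fun i => (m i : ℝ)) + (x + Pi.single i ((1 : Fin r → ℝ) i)))) m =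
        ∑' m, (A ∩ {m | m i ≠ 0}).indicator f m := by
      have hinj : Function.Injective fun m : Fin r → ℕ => m + Pi.single i 1 :=
        add_left_injective _
      rw [← hinj.tsum_eq (f := (A ∩ {m | m i ≠ 0}).indicator f)]
      · refine tsum_congr fun m => ?_
        have hmem : m + Pi.single i 1 ∈ A ∩ {m | m i ≠ 0} ↔ m ∈ A := by
          simp only [A, Set.mem_inter_iff, Set.mem_ofPred_eq, Pi.add_apply, Pi.single_eq_same]
          refine ⟨fun h j hj => by have := h.1 j hj; omega, fun h => ⟨fun j hj => ?_, by omega⟩⟩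
          rw [h j hj, Pi.single_eq_of_ne (ne_of_mem_of_not_mem hj hi), add_zero]
        by_cases hm : m ∈ A
        · rw [Set.indicator_of_mem hm, Set.indicator_of_mem (hmem.2 hm)]
          simp only [f]
          congr 1
          ext j
          by_cases hj : j = i
          · subst hj; simp; ring
          · simp [Pi.single_eq_of_ne hj]
        · rw [Set.indicator_of_notMem hm, Set.indicator_of_notMem (hmem.not.2 hm)]
      · intro m hm
        have hmA : m ∈ A ∩ {m | m i ≠ 0} := Set.mem_of_indicator_ne_zero hm
        have hm' : m i ≠ 0 := hmA.2
        refine ⟨m - Pi.single i 1, ?_⟩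
        ext j
        by_cases hj : j = i
        · subst hj; simp; omega
        · simp [Pi.single_eq_of_ne hj]
    have hset : {m : Fin r → ℕ | ∀ j ∈ i :: L, m j = 0} = A \ (A ∩ {m | m i ≠ 0}) := by
      ext m
      simp only [A, List.mem_cons, forall_eq_or_imp, Set.mem_ofPred_eq, Set.mem_sdiff,
        Set.mem_inter_iff]
      tauto
    rw [hshift, hset, Set.indicator_sdiff Set.inter_subset_left]
    simp only [Pi.sub_apply]
    rw [(hf.indicator A).tsum_sub (hf.indicator _)]
    ring

lemma foldr_finRange_shiftDiff_zetaRS (S : RootSystemData r E) {s : ℂ} (hs : 1 < s.re)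
    {x : Fin r → ℝ} (hx : ∀ i, 0 < x i) :
    (List.finRange r).foldr (shiftDiff 1) (zetaRS S s) x = (-1) ^ r * S.zetaTerm s x := by
  rw [foldr_shiftDiff_zetaRS S hs _ (List.nodup_finRange r) x hx, List.length_finRange,
    tsum_eq_single 0]
  · rw [Set.indicator_of_mem (by simp)]
    congr 2
    ext j
    simp
  · intro m hm
    exact Set.indicator_of_notMem (fun h : ∀ i ∈ List.finRange r, m i = 0 =>
      hm (funext fun i => h i (List.mem_finRange i))) _

/-- The points above `x` in every coordinate which exceed `x` by at most `h i` in each of the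
coordinates in `L`. -/
def slab {m : ℕ} (h : Fin m → ℝ) (L : List (Fin m)) (x : Fin m → ℝ) : Set (Fin m → ℝ) :=
  {u | ∀ i, x i < u i ∧ (i ∈ L → u i ≤ x i + h i)}

lemma measurableSet_slab {m : ℕ} (h : Fin m → ℝ) (L : List (Fin m)) (x : Fin m → ℝ) :
    MeasurableSet (slab h L x) := by
  have : slab h L x = ⋂ i, ({u | x i < u i} ∩ {u | i ∈ L → u i ≤ x i + h i}) := by
    ext u
    simp [slab]
  rw [this]
  refine MeasurableSet.iInter fun i => (measurableSet_lt measurable_const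
    (measurable_pi_apply i)).inter ?_
  by_cases hi : i ∈ L
  · simpa [hi] using measurableSet_le (measurable_pi_apply i) measurable_const
  · simp [hi]

lemma slab_nil {m : ℕ} (h : Fin m → ℝ) (x : Fin m → ℝ) :
    slab h [] x = Set.univ.pi fun i => Set.Ioi (x i) := by
  ext u
  simp [slab]

lemma slab_finRange {m : ℕ} (h : Fin m → ℝ) (x : Fin m → ℝ) :
    slab h (List.finRange m) x = Set.univ.pi fun i => Set.Ioc (x i) (x i + h i) := by
  ext u
  simp [slab]

lemma slab_cons {m : ℕ} {h : Fin m → ℝ} {i : Fin m} {L : List (Fin m)} (hi : i ∉ L)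
    (x : Fin m → ℝ) :
    slab h (i :: L) x = slab h L x \ slab h L (x + Pi.single i (h i)) := by
  ext u
  simp only [slab, Set.mem_ofPred_eq, Set.mem_sdiff, List.mem_cons]
  constructor
  · intro hu
    refine ⟨fun j => ⟨(hu j).1, fun hj => (hu j).2 (Or.inr hj)⟩, fun hv => ?_⟩
    have h1 := (hu i).2 (Or.inl rfl)
    have h2 := (hv i).1
    simp only [Pi.add_apply, Pi.single_eq_same] at h2
    linarith
  · rintro ⟨hu, hv⟩ j
    refine ⟨(hu j).1, ?_⟩
    rintro (rfl | hj)
    · by_contra! hlt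
      refine hv fun k => ?_
      by_cases hk : k = j
      · subst hk
        exact ⟨by simpa using hlt, fun hk => absurd hk hi⟩
      · simpa [Pi.single_eq_of_ne hk] using hu k
    · exact (hu j).2 hj

lemma slab_add_single_subset {m : ℕ} {h : Fin m → ℝ} (hh : ∀ i, 0 ≤ h i) {i : Fin m}
    {L : List (Fin m)} (hi : i ∉ L) (x : Fin m → ℝ) :
    slab h L (x + Pi.single i (h i)) ⊆ slab h L x := by
  intro u hu k
  have hk := hu k
  by_cases hki : k = i
  · subst hki
    simp only [Pi.add_apply, Pi.single_eq_same] at hk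
    exact ⟨by linarith [hh k], fun hk => absurd hk hi⟩
  · simpa [Pi.single_eq_of_ne hki] using hk

lemma integrableOn_zetaTerm (S : RootSystemData r E) {s : ℂ} (hs : 1 < s.re) {x : Fin r → ℝ}
    (hx : ∀ i, 0 < x i) (h : Fin r → ℝ) (L : List (Fin r)) :
    IntegrableOn (S.zetaTerm s) (slab h L x) := by
  have hsub : slab h L x ⊆ slab h [] x := fun u hu i => ⟨(hu i).1, by simp⟩
  refine IntegrableOn.mono_set ?_ hsub
  obtain ⟨C, -, hC⟩ := S.exists_norm_zetaTerm_le (by linarith : 0 ≤ s.re) hx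
  have hprod : IntegrableOn (fun u : Fin r → ℝ => C * ∏ i, u i ^ (-s.re)) (slab h [] x) := by
    refine Integrable.const_mul ?_ C
    rw [slab_nil, volume_pi, Measure.restrict_pi_pi]
    exact Integrable.fintype_prod (f := fun _ t => t ^ (-s.re)) fun i =>
      integrableOn_Ioi_rpow_of_lt (by linarith) (hx i)
  refine hprod.mono' (S.measurable_zetaTerm s).aestronglyMeasurable ?_
  filter_upwards [ae_restrict_mem (measurableSet_slab h [] x)] with u hu
  exact hC u fun i => (hu i).1.le

lemma zetaIntRS_eq_setIntegral (S : RootSystemData r E) (s : ℂ) (h x : Fin r → ℝ) :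
    zetaIntRS S s x = ∫ u in slab h [] x, S.zetaTerm s u := by
  have := (measurePreserving_add_right (volume : Measure (Fin r → ℝ)) x).setIntegral_preimage_emb
    (measurableEmbedding_addRight x) (S.zetaTerm s) (slab h [] x)
  rw [← this]
  have hset : (fun u => u + x) ⁻¹' slab h [] x = {t : Fin r → ℝ | ∀ i, 0 < t i} := by
    ext t
    simp [slab]
  rw [hset]
  rfl

lemma foldr_shiftDiff_zetaIntRS (S : RootSystemData r E) {s : ℂ} (hs : 1 < s.re)
    {h : Fin r → ℝ} (hh : ∀ i, 0 ≤ h i) (L : List (Fin r)) (hL : L.Nodup) :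
    ∀ x : Fin r → ℝ, (∀ i, 0 < x i) → L.foldr (shiftDiff h) (zetaIntRS S s) x =
      (-1) ^ L.length * ∫ u in slab h L x, S.zetaTerm s u := by
  induction L with
  | nil => intro x _; simp [zetaIntRS_eq_setIntegral S s h]
  | cons i L ih =>
    obtain ⟨hi, hL⟩ := List.nodup_cons.1 hL
    intro x hx
    simp only [List.foldr_cons, shiftDiff, List.length_cons]
    rw [ih hL x hx, ih hL _ (add_single_pos hh hx i), slab_cons hi, setIntegral_sdiff
      (measurableSet_slab _ _ _) (integrableOn_zetaTerm S hs hx h L)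
      (slab_add_single_subset hh hi x)]
    ring

/-- The integral of the zeta term over a box in the positive orthant is an entire function. -/
lemma differentiable_setIntegral_zetaTerm (S : RootSystemData r E) {x : Fin r → ℝ}
    (hx : ∀ i, 0 < x i) (h : Fin r → ℝ) :
    Differentiable ℂ fun s => ∫ u in slab h (List.finRange r) x, S.zetaTerm s u := by
  set B := slab h (List.finRange r) x with hB
  set X : (Fin r → ℝ) → ℝ := fun u => -∑ α ∈ S.pos, Real.log (S.linForm α u) with hX
  set K : Set (Fin r → ℝ) := Set.univ.pi fun i => Set.Icc (x i) (x i + h i)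
  have hBK : B ⊆ K := by
    rw [hB, slab_finRange]
    exact Set.pi_mono fun i _ => Set.Ioc_subset_Icc_self
  have hKpos : ∀ u ∈ K, ∀ i, 0 < u i := fun u hu i => (hx i).trans_le (hu i trivial).1
  have hK : IsCompact K := isCompact_univ_pi fun i => isCompact_Icc
  have hXK : ContinuousOn X K := by
    refine (continuousOn_finsetSum _ fun α hα => ?_).neg
    exact (S.continuous_linForm α).continuousOn.log fun u hu =>
      (S.linForm_pos hα (hKpos u hu)).ne'
  have hint : ∀ t : ℝ, Integrable (fun u => Real.exp (t * X u)) (volume.restrict B) := fun t =>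
    ((Real.continuous_exp.comp_continuousOn
      (continuousOn_const.mul hXK)).integrableOn_compact hK).mono_set hBK
  have hset : ProbabilityTheory.integrableExpSet X (volume.restrict B) = Set.univ :=
    Set.eq_univ_of_forall hint
  have heq : (fun s => ∫ u in B, S.zetaTerm s u) =
      ProbabilityTheory.complexMGF X (volume.restrict B) := by
    ext s
    refine setIntegral_congr_fun (measurableSet_slab _ _ _) fun u hu => ?_
    simp only [RootSystemData.zetaTerm, hX]
    push_cast
    rw [mul_neg, ← neg_mul, Finset.mul_sum, Complex.exp_sum]
    refine Finset.prod_congr rfl fun α hα => ?_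
    have hp := S.linForm_pos hα (hKpos u (hBK hu))
    rw [Complex.cpow_def_of_ne_zero (by exact_mod_cast hp.ne'), ← Complex.ofReal_log hp.le,
      mul_comm]
  rw [heq]
  intro s
  exact (ProbabilityTheory.hasDerivAt_complexMGF (by simp [hset])).differentiableAt

lemma integrableOn_slab_finRange {m : ℕ} {k : (Fin m → ℝ) → ℂ} (hk : Continuous k)
    (h x : Fin m → ℝ) : IntegrableOn k (slab h (List.finRange m) x) := by
  rw [slab_finRange]
  exact (hk.continuousOn.integrableOn_compact
    (isCompact_univ_pi fun i => isCompact_Icc)).mono_set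
      (Set.pi_mono fun i _ => Set.Ioc_subset_Icc_self)

/-- The complex valued function on `ℝ^m` defined by a complex polynomial. -/
def polyFun {m : ℕ} (p : MvPolynomial (Fin m) ℂ) (x : Fin m → ℝ) : ℂ :=
  MvPolynomial.eval (fun i => (x i : ℂ)) p

lemma continuous_polyFun {m : ℕ} (p : MvPolynomial (Fin m) ℂ) : Continuous (polyFun p) :=
  (MvPolynomial.continuous_eval p).comp (by fun_prop)

lemma polyFun_add {m : ℕ} (p q : MvPolynomial (Fin m) ℂ) :
    polyFun (p + q) = polyFun p + polyFun q := by
  ext x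
  simp [polyFun]

lemma polyFun_monomial {m : ℕ} (u : Fin m →₀ ℕ) (a : ℂ) (x : Fin m → ℝ) :
    polyFun (MvPolynomial.monomial u a) x = a * ∏ i, (x i : ℂ) ^ u i := by
  rw [polyFun, MvPolynomial.eval_monomial, Finsupp.prod_fintype _ _ (by simp)]

/-- Polynomial functions are determined by their values on the positive orthant. -/
lemma polyFun_eq_of_pos {m : ℕ} {p q : MvPolynomial (Fin m) ℂ}
    (h : ∀ x : Fin m → ℝ, (∀ i, 0 < x i) → polyFun p x = polyFun q x) : p = q := by
  refine MvPolynomial.funext_set (fun _ => Complex.ofReal '' Set.Ioi 0)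
    (fun _ => (Set.Ioi_infinite 0).image Complex.ofReal_injective.injOn) fun y hy => ?_
  choose! x hx hxy using fun i => hy i trivial
  have : y = fun i => (x i : ℂ) := funext fun i => (hxy i).symm
  rw [this]
  exact h x hx

lemma hasFDerivAt_polyFun {m : ℕ} (p : MvPolynomial (Fin m) ℂ) (x : Fin m → ℝ) :
    ∃ D : (Fin m → ℝ) →L[ℝ] ℂ, HasFDerivAt (polyFun p) D x ∧
      ∀ i, D (Pi.single i 1) = polyFun (MvPolynomial.pderiv i p) x := by
  induction p using MvPolynomial.induction_on with
  | C a =>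
    refine ⟨0, ?_, fun i => by simp [polyFun]⟩
    have : polyFun (MvPolynomial.C a : MvPolynomial (Fin m) ℂ) = fun _ => a := by
      ext; simp [polyFun]
    rw [this]
    exact hasFDerivAt_const a x
  | add p q hp hq =>
    obtain ⟨D, hD, hD'⟩ := hp
    obtain ⟨D₁, hD₁, hD₁'⟩ := hq
    refine ⟨D + D₁, by rw [polyFun_add]; exact hD.add hD₁, fun i => ?_⟩
    simp [map_add, polyFun_add, hD', hD₁']
  | mul_X p j hp =>
    obtain ⟨D, hD, hD'⟩ := hp
    have hX : HasFDerivAt (fun y : Fin m → ℝ => (y j : ℂ))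
        (Complex.ofRealCLM.comp (ContinuousLinearMap.proj j)) x :=
      (Complex.ofRealCLM.comp (ContinuousLinearMap.proj (R := ℝ) (φ := fun _ : Fin m => ℝ)
        j)).hasFDerivAt
    have hmul : polyFun (p * MvPolynomial.X j) = fun y => polyFun p y * (y j : ℂ) := by
      ext y; simp [polyFun]
    refine ⟨_, by rw [hmul]; exact hD.mul hX, fun i => ?_⟩
    by_cases hij : i = j
    · subst hij
      simp [hD', polyFun, MvPolynomial.pderiv_X, Derivation.leibniz]
    · simp [hD', polyFun, MvPolynomial.pderiv_X, Derivation.leibniz,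
        Pi.single_eq_of_ne (Ne.symm hij)]

lemma foldr_pder_polyFun {m : ℕ} (p : MvPolynomial (Fin m) ℂ) (L : List (Fin m)) :
    L.foldr (fun i acc => pder i acc) (polyFun p) =
      polyFun (L.foldr (fun i q => MvPolynomial.pderiv i q) p) := by
  induction L with
  | nil => rfl
  | cons i L ih =>
    ext x
    obtain ⟨D, hD, hD'⟩ := hasFDerivAt_polyFun
      (L.foldr (fun i q => MvPolynomial.pderiv i q) p) x
    rw [List.foldr_cons, ih, List.foldr_cons, pder, hD.fderiv, ← hD' i]

lemma shiftDiff_polyFun {m : ℕ} (h : Fin m → ℝ) (i : Fin m) (p : MvPolynomial (Fin m) ℂ) :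
    ∃ q, shiftDiff h i (polyFun p) = polyFun q := by
  refine ⟨MvPolynomial.bind₁ (fun j => MvPolynomial.X j +
    MvPolynomial.C (((Pi.single i (h i) : Fin m → ℝ) j : ℝ) : ℂ)) p - p, ?_⟩
  ext x
  simp only [shiftDiff, polyFun, map_sub, ← MvPolynomial.coe_aeval_eq_eval,
    RingHom.coe_coe, MvPolynomial.aeval_bind₁]
  simp

lemma foldr_shiftDiff_polyFun {m : ℕ} (h : Fin m → ℝ) (p : MvPolynomial (Fin m) ℂ)
    (L : List (Fin m)) : ∃ q, L.foldr (shiftDiff h) (polyFun p) = polyFun q := by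
  induction L with
  | nil => exact ⟨p, rfl⟩
  | cons i L ih =>
    obtain ⟨q, hq⟩ := ih
    rw [List.foldr_cons, hq]
    exact shiftDiff_polyFun h i q

lemma foldr_shiftDiff_add {m : ℕ} (h : Fin m → ℝ) (f g : (Fin m → ℝ) → ℂ) (L : List (Fin m)) :
    L.foldr (shiftDiff h) (f + g) = L.foldr (shiftDiff h) f + L.foldr (shiftDiff h) g := by
  induction L with
  | nil => rfl
  | cons i L ih =>
    ext x
    simp only [List.foldr_cons, ih, shiftDiff, Pi.add_apply]
    ring

lemma foldr_pderiv_add {m : ℕ} (p q : MvPolynomial (Fin m) ℂ) (L : List (Fin m)) :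
    L.foldr (fun i q => MvPolynomial.pderiv i q) (p + q) =
      L.foldr (fun i q => MvPolynomial.pderiv i q) p +
        L.foldr (fun i q => MvPolynomial.pderiv i q) q := by
  induction L with
  | nil => rfl
  | cons i L ih => simp [ih]

lemma foldr_shiftDiff_prod {m : ℕ} (h : Fin m → ℝ) (a : ℂ) (g : Fin m → ℝ → ℂ)
    (L : List (Fin m)) (hL : L.Nodup) (x : Fin m → ℝ) :
    L.foldr (shiftDiff h) (fun y => a * ∏ i, g i (y i)) x =
      a * ∏ i, if i ∈ L then g i (x i + h i) - g i (x i) else g i (x i) := by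
  induction L generalizing x with
  | nil => simp
  | cons i L ih =>
    obtain ⟨hi, hL⟩ := List.nodup_cons.1 hL
    simp only [List.foldr_cons, shiftDiff]
    rw [ih hL, ih hL]
    simp only [← Finset.mul_prod_erase Finset.univ _ (Finset.mem_univ i), if_neg hi,
      List.mem_cons, true_or, if_true, Pi.add_apply, Pi.single_eq_same]
    have h1 : ∀ j ∈ Finset.univ.erase i,
        (if j ∈ L then g j (x j + (Pi.single i (h i) : Fin m → ℝ) j + h j) -
            g j (x j + (Pi.single i (h i) : Fin m → ℝ) j)
          else g j (x j + (Pi.single i (h i) : Fin m → ℝ) j)) =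
        if j ∈ L then g j (x j + h j) - g j (x j) else g j (x j) := fun j hj => by
      simp [Pi.single_eq_of_ne (Finset.ne_of_mem_erase hj)]
    have h2 : ∀ j ∈ Finset.univ.erase i,
        (if j = i ∨ j ∈ L then g j (x j + h j) - g j (x j) else g j (x j)) =
        if j ∈ L then g j (x j + h j) - g j (x j) else g j (x j) := fun j hj => by
      simp [Finset.ne_of_mem_erase hj]
    rw [Finset.prod_congr rfl h1, Finset.prod_congr rfl h2]
    ring

lemma foldr_pderiv_monomial {m : ℕ} (u : Fin m →₀ ℕ) (a : ℂ) (L : List (Fin m))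
    (hL : L.Nodup) :
    L.foldr (fun i q => MvPolynomial.pderiv i q) (MvPolynomial.monomial u a) =
      MvPolynomial.monomial
        (Finsupp.equivFunOnFinite.symm fun i => if i ∈ L then u i - 1 else u i)
        (a * (L.map fun i => (u i : ℂ)).prod) := by
  induction L with
  | nil =>
    simp
  | cons i L ih =>
    obtain ⟨hi, hL⟩ := List.nodup_cons.1 hL
    rw [List.foldr_cons, ih hL, MvPolynomial.pderiv_monomial]
    refine congrArg₂ (fun v b => MvPolynomial.monomial v b) ?_ ?_
    · ext j
      by_cases hj : j = i
      · subst hj; simp [hi]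
      · simp [hj]
    · simp [hi]
      ring

lemma polyFun_foldr_finRange_pderiv_monomial {m : ℕ} (u : Fin m →₀ ℕ) (a : ℂ)
    (x : Fin m → ℝ) :
    polyFun ((List.finRange m).foldr (fun i q => MvPolynomial.pderiv i q)
      (MvPolynomial.monomial u a)) x = a * ∏ i, (u i : ℂ) * (x i : ℂ) ^ (u i - 1) := by
  rw [foldr_pderiv_monomial _ _ _ (List.nodup_finRange m), polyFun_monomial,
    Finset.prod_mul_distrib, ← mul_assoc, Fin.prod_univ_def fun i => (u i : ℂ)]
  simp

/-- The mixed difference of a polynomial is the integral over a box of its mixed derivative. -/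
lemma foldr_shiftDiff_polyFun_eq_setIntegral {m : ℕ} {h : Fin m → ℝ} (hh : ∀ i, 0 ≤ h i)
    (p : MvPolynomial (Fin m) ℂ) (x : Fin m → ℝ) :
    (List.finRange m).foldr (shiftDiff h) (polyFun p) x =
      ∫ t in slab h (List.finRange m) x,
        polyFun ((List.finRange m).foldr (fun i q => MvPolynomial.pderiv i q) p) t := by
  have hint : ∀ q : MvPolynomial (Fin m) ℂ,
      IntegrableOn (polyFun q) (slab h (List.finRange m) x) := fun q =>
    integrableOn_slab_finRange (continuous_polyFun q) h x
  induction p using MvPolynomial.induction_on' with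
  | monomial u a =>
    simp only [polyFun_foldr_finRange_pderiv_monomial]
    have hmon : polyFun (MvPolynomial.monomial u a) =
        fun y : Fin m → ℝ => a * ∏ i, (fun t : ℝ => (t : ℂ) ^ u i) (y i) :=
      funext (polyFun_monomial u a)
    rw [hmon, foldr_shiftDiff_prod h a (fun i (t : ℝ) => (t : ℂ) ^ u i) _
        (List.nodup_finRange m), integral_const_mul, slab_finRange, volume_pi, Measure.restrict_pi_pi,
      integral_fintype_prod_eq_prod (fun i (t : ℝ) => (u i : ℂ) * (t : ℂ) ^ (u i - 1))]
    congr 1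
    refine Finset.prod_congr rfl fun i _ => ?_
    rw [if_pos (List.mem_finRange i),
      ← intervalIntegral.integral_of_le (le_add_of_nonneg_right (hh i)),
      intervalIntegral.integral_eq_sub_of_hasDerivAt
        (fun t _ => (hasDerivAt_pow (u i) (t : ℂ)).comp_ofReal)]
    exact (by fun_prop : Continuous fun t : ℝ => (u i : ℂ) * (t : ℂ) ^ (u i - 1)).intervalIntegrable
      _ _
  | add p q hp hq =>
    rw [polyFun_add, foldr_shiftDiff_add, Pi.add_apply, hp, hq, foldr_pderiv_add, polyFun_add]
    exact (integral_add (hint _) (hint _)).symm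

/-- A continuous function whose integrals over all small boxes with corner `x` vanish is zero at
`x`. -/
lemma eq_zero_of_setIntegral_slab_eq_zero {m : ℕ} {k : (Fin m → ℝ) → ℂ} (hk : Continuous k)
    {x : Fin m → ℝ}
    (hint : ∀ ε : ℝ, 0 < ε → ∫ t in slab (fun _ => ε) (List.finRange m) x, k t = 0) :
    k x = 0 := by
  by_contra hne
  have hpos : 0 < ‖k x‖ := norm_pos_iff.2 hne
  obtain ⟨δ, hδ, hball⟩ := Metric.continuousAt_iff.1 hk.continuousAt (‖k x‖ / 2) (half_pos hpos)
  set B := slab (fun _ => δ / 2) (List.finRange m) x with hB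
  have hvol : volume B = ENNReal.ofReal (δ / 2) ^ m := by
    rw [hB, slab_finRange, Real.volume_pi_Ioc]
    simp
  have hfin : volume B < ⊤ := by
    rw [hvol]
    exact ENNReal.pow_lt_top ENNReal.ofReal_lt_top
  have hreal : 0 < volume.real B := by
    rw [measureReal_def, hvol, ENNReal.toReal_pow, ENNReal.toReal_ofReal (by positivity)]
    positivity
  have hkB : IntegrableOn k B := integrableOn_slab_finRange hk _ x
  have hle : ‖∫ t in B, (k t - k x)‖ ≤ ‖k x‖ / 2 * volume.real B := by
    refine norm_setIntegral_le_of_norm_le_const hfin fun t ht => ?_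
    rw [← dist_eq_norm]
    refine (hball ?_).le
    refine (dist_pi_lt_iff hδ).2 fun i => ?_
    have h1 := (ht i).1
    have h2 := (ht i).2 (List.mem_finRange i)
    rw [Real.dist_eq, abs_of_pos (sub_pos.2 h1)]
    linarith
  rw [integral_sub hkB (integrableOn_const hfin.ne), hint _ (half_pos hδ),
    setIntegral_const, zero_sub, norm_neg, norm_smul, Real.norm_of_nonneg hreal.le] at hle
  nlinarith [mul_pos hreal hpos]

lemma zetaTerm_neg_natCast_eq_polyFun (S : RootSystemData r E) (l : ℕ) :
    ∃ p, S.zetaTerm (-(l : ℂ)) = polyFun p := by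
  refine ⟨(∏ α ∈ S.pos, ∑ k, MvPolynomial.X k * MvPolynomial.C (S.pairing k α : ℂ)) ^ l, ?_⟩
  ext x
  rw [S.zetaTerm_neg_natCast]
  simp [polyFun, RootSystemData.linForm]

/-- `(Δ_{e_1}∘⋯∘Δ_{e_r})(P_ℓ)(x) = (-1)^r (Π_{α∈Φ⁺} Σ_k x_k (λ_k,α^∨))^ℓ`, and the
same polynomial equals `∂^r Q_ℓ/∂x_1⋯∂x_r`. -/
theorem delta_Pl_and_deriv_Ql {r : ℕ} (hr : 0 < r) {E : Type*} [NormedAddCommGroup E]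
    [InnerProductSpace ℝ E] (hdim : Module.finrank ℝ E = r)
    (S : RootSystemData r E) (l : ℕ)
    (P Q : (Fin r → ℝ) → ℂ)
    (hPpoly : ∃ p : MvPolynomial (Fin r) ℂ,
      ∀ x : Fin r → ℝ, P x = MvPolynomial.eval (fun i => (x i : ℂ)) p)
    (hPval : ∀ x : Fin r → ℝ, (∀ i, 0 < x i) → IsPValue S l x (P x))
    (hQpoly : ∃ q : MvPolynomial (Fin r) ℂ,
      ∀ x : Fin r → ℝ, Q x = MvPolynomial.eval (fun i => (x i : ℂ)) q)
    (hQval : ∀ x : Fin r → ℝ, (∀ i, 0 < x i) → IsQValue S l x (Q x)) :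
    ∀ x : Fin r → ℝ,
      deltaAll P x =
        (-1 : ℂ) ^ r * ((∏ α ∈ S.pos, ((∑ k, x k * S.pairing k α : ℝ) : ℂ)) ^ l) ∧
      mixedDeriv Q x =
        (-1 : ℂ) ^ r * ((∏ α ∈ S.pos, ((∑ k, x k * S.pairing k α : ℝ) : ℂ)) ^ l) := by
  obtain ⟨p, hp⟩ := hPpoly
  obtain ⟨q, hq⟩ := hQpoly
  obtain rfl : P = polyFun p := funext hp
  obtain rfl : Q = polyFun q := funext hq
  obtain ⟨g, hg⟩ := zetaTerm_neg_natCast_eq_polyFun S l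
  have hr1 : ∀ s : ℂ, (r : ℝ) < s.re → 1 < s.re := fun s hs =>
    lt_of_le_of_lt (by exact_mod_cast hr) hs
  have hrhs : ∀ x : Fin r → ℝ, (-1 : ℂ) ^ r *
      ((∏ α ∈ S.pos, ((∑ k, x k * S.pairing k α : ℝ) : ℂ)) ^ l) =
      polyFun (MvPolynomial.C ((-1) ^ r) * g) x := fun x => by
    have : polyFun (MvPolynomial.C ((-1) ^ r) * g) x = (-1) ^ r * polyFun g x := by simp [polyFun]
    rw [this, ← hg, S.zetaTerm_neg_natCast]
    rfl
  simp only [hrhs]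
  intro x
  constructor
  · obtain ⟨d, hd⟩ := foldr_shiftDiff_polyFun 1 p (List.finRange r)
    have hdelta : deltaAll (polyFun p) = polyFun d := hd
    rw [hdelta]
    refine congrArg (polyFun · x) (polyFun_eq_of_pos fun y hy => ?_)
    rw [← hd, ← hrhs, foldr_shiftDiff_continuation (h := 1) (fun _ => zero_le_one) hPval
      (G := fun s => (-1) ^ r * S.zetaTerm s y) ((S.differentiable_zetaTerm hy).const_mul _) _ hy
      fun s hs => foldr_finRange_shiftDiff_zetaRS S (hr1 s hs) hy, S.zetaTerm_neg_natCast]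
    rfl
  · rw [mixedDeriv, foldr_pder_polyFun]
    refine congrArg (polyFun · x) (polyFun_eq_of_pos fun y hy => sub_eq_zero.1 ?_)
    set d := (List.finRange r).foldr (fun i q => MvPolynomial.pderiv i q) q
    set e := MvPolynomial.C ((-1) ^ r) * g with he
    refine eq_zero_of_setIntegral_slab_eq_zero (k := fun t => polyFun d t - polyFun e t)
      ((continuous_polyFun d).sub (continuous_polyFun e)) fun ε hε => ?_
    have hε' : ∀ i : Fin r, 0 ≤ (fun _ => ε : Fin r → ℝ) i := fun _ => hε.le
    have hint : ∀ k : MvPolynomial (Fin r) ℂ,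
        IntegrableOn (polyFun k) (slab (fun _ => ε) (List.finRange r) y) := fun k =>
      integrableOn_slab_finRange (continuous_polyFun k) _ y
    rw [integral_sub (hint d) (hint e), ← foldr_shiftDiff_polyFun_eq_setIntegral hε',
      foldr_shiftDiff_continuation hε' hQval
        (G := fun s => (-1) ^ r * ∫ u in slab (fun _ => ε) (List.finRange r) y, S.zetaTerm s u)
        ((differentiable_setIntegral_zetaTerm S hy _).const_mul _) _ hy fun s hs => by
          rw [foldr_shiftDiff_zetaIntRS S (hr1 s hs) hε' _ (List.nodup_finRange r) y hy,
            List.length_finRange],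
      ← integral_const_mul, sub_eq_zero]
    refine integral_congr_ae (Filter.Eventually.of_forall fun t => ?_)
    simp [he, hg, polyFun]
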